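/- arXiv:1804.06123 — 4 statements merged into one kernel-verified Lean document; each statement's English description precedes it below -/
import Mathlib

section
/- Under the adapted cuspidal-edge setting, define the extended principal vector field Ṽ = Ṽ₁∂_u + Ṽ₂∂_v with respect to the unbounded principal curvature by Ṽ₁ = v(λM̃ − κ̂F̃) and Ṽ₂ = −λL̃ + κ̂Ẽ, and call a point p = (u₀,0) on the u-axis a sub-parabolic point if the directional derivative Ṽκ(p) = Ṽ₁(p)κ_u(p) + Ṽ₂(p)κ_v(p) vanishes. Then p = (u₀,0) is a sub-parabolic point if and only if 4κ_t(u₀)² + κ_s(u₀)κ_c(u₀)² = 0. -/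
noncomputable section

local notation "⟪" x ", " y "⟫" => @inner ℝ _ _ x y

/-- Euclidean 3-space. -/
abbrev E3 : Type := EuclideanSpace ℝ (Fin 3)

/-- The vector in `E3` with coordinates `(a, b, c)`. -/
def e3 (a b c : ℝ) : E3 := (WithLp.equiv 2 (Fin 3 → ℝ)).symm ![a, b, c]

/-- Cross product on `E3`. -/
def cross3 (a b : E3) : E3 :=
  e3 (a 1 * b 2 - a 2 * b 1) (a 2 * b 0 - a 0 * b 2) (a 0 * b 1 - a 1 * b 0)

/-- Scalar triple product `det(a,b,c)`. -/
def det3 (a b c : E3) : ℝ := ⟪a, cross3 b c⟫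

/-- Partial derivative in the `u`-direction. -/
def pu {E : Type*} [NormedAddCommGroup E] [NormedSpace ℝ E] (g : ℝ × ℝ → E) (p : ℝ × ℝ) : E :=
  fderiv ℝ g p (1, 0)

/-- Partial derivative in the `v`-direction. -/
def pv {E : Type*} [NormedAddCommGroup E] [NormedSpace ℝ E] (g : ℝ × ℝ → E) (p : ℝ × ℝ) : E :=
  fderiv ℝ g p (0, 1)

/-- Signed area density `λ = det(f_u, f_v, ν)`. -/
def lam (f ν : ℝ × ℝ → E3) (p : ℝ × ℝ) : ℝ := det3 (pu f p) (pv f p) (ν p)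


/-- `Ẽ = |f_u|²`. -/
def Etil (f : ℝ × ℝ → E3) (p : ℝ × ℝ) : ℝ := ‖pu f p‖ ^ 2

/-- `F̃ = ⟨f_u, h⟩`. -/
def Ftil (f h : ℝ × ℝ → E3) (p : ℝ × ℝ) : ℝ := ⟪pu f p, h p⟫

/-- `G̃ = |h|²`. -/
def Gtil (h : ℝ × ℝ → E3) (p : ℝ × ℝ) : ℝ := ‖h p‖ ^ 2

/-- `L̃ = −⟨f_u, ν_u⟩`. -/
def Ltil (f ν : ℝ × ℝ → E3) (p : ℝ × ℝ) : ℝ := -⟪pu f p, pu ν p⟫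

/-- `M̃ = −⟨h, ν_u⟩`. -/
def Mtil (ν h : ℝ × ℝ → E3) (p : ℝ × ℝ) : ℝ := -⟪h p, pu ν p⟫

/-- `Ñ = −⟨h, ν_v⟩`. -/
def Ntil (ν h : ℝ × ℝ → E3) (p : ℝ × ℝ) : ℝ := -⟪h p, pv ν p⟫

/-- `Ã = ẼÑ − 2vF̃M̃ + vG̃L̃`. -/
def Atil (f ν h : ℝ × ℝ → E3) (p : ℝ × ℝ) : ℝ :=
  Etil f p * Ntil ν h p - 2 * p.2 * Ftil f h p * Mtil ν h p + p.2 * Gtil h p * Ltil f ν p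

/-- `B̃ = √(Ã² − 4v(ẼG̃−F̃²)(L̃Ñ−vM̃²))`. -/
def Btil (f ν h : ℝ × ℝ → E3) (p : ℝ × ℝ) : ℝ :=
  Real.sqrt ((Atil f ν h p) ^ 2 -
    4 * p.2 * (Etil f p * Gtil h p - (Ftil f h p) ^ 2) *
      (Ltil f ν p * Ntil ν h p - p.2 * (Mtil ν h p) ^ 2))

/-- The bounded principal curvature `κ = 2(L̃Ñ−vM̃²)/(Ã+B̃)`. -/
def kap (f ν h : ℝ × ℝ → E3) (p : ℝ × ℝ) : ℝ :=
  2 * (Ltil f ν p * Ntil ν h p - p.2 * (Mtil ν h p) ^ 2) / (Atil f ν h p + Btil f ν h p)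

/-- `κ̂ = (Ã+B̃)/(2|f_u×h|)`, the smooth extension of `λ·κ₁`. -/
def kaphat (f ν h : ℝ × ℝ → E3) (p : ℝ × ℝ) : ℝ :=
  (Atil f ν h p + Btil f ν h p) / (2 * ‖cross3 (pu f p) (h p)‖)

/-- Singular curvature `κ_s` along the u-axis. -/
def kappas (f ν : ℝ × ℝ → E3) (u : ℝ) : ℝ :=
  det3 (pu f (u, 0)) (pu (pu f) (u, 0)) (ν (u, 0)) / ‖pu f (u, 0)‖ ^ 3

/-- Cuspidal curvature `κ_c` along the u-axis. -/
def kappac (f ν h : ℝ × ℝ → E3) (u : ℝ) : ℝ :=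
  2 * Etil f (u, 0) ^ ((3 : ℝ) / 4) * Ntil ν h (u, 0) /
    (Etil f (u, 0) * Gtil h (u, 0) - (Ftil f h (u, 0)) ^ 2) ^ ((3 : ℝ) / 4)

/-- Cusp-directional torsion `κ_t` along the u-axis. -/
def kappat (f ν h : ℝ × ℝ → E3) (u : ℝ) : ℝ :=
  (Etil f (u, 0) * Mtil ν h (u, 0) - Ftil f h (u, 0) * Ltil f ν (u, 0)) /
    (Etil f (u, 0) * Real.sqrt (Etil f (u, 0) * Gtil h (u, 0) - (Ftil f h (u, 0)) ^ 2))

/-- The focal surface `ŴFC_f = f + (λ/κ̂)ν`. -/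
def FChat (f ν h : ℝ × ℝ → E3) (p : ℝ × ℝ) : E3 :=
  f p + (lam f ν p / kaphat f ν h p) • ν p

/-- Coefficient `E` of the first fundamental form of a surface `W`. -/
def surfE (W : ℝ × ℝ → E3) (p : ℝ × ℝ) : ℝ := ‖pu W p‖ ^ 2

/-- Coefficient `F` of the first fundamental form of a surface `W`. -/
def surfF (W : ℝ × ℝ → E3) (p : ℝ × ℝ) : ℝ := ⟪pu W p, pv W p⟫

/-- Coefficient `G` of the first fundamental form of a surface `W`. -/
def surfG (W : ℝ × ℝ → E3) (p : ℝ × ℝ) : ℝ := ‖pv W p‖ ^ 2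

/-- Unit normal `n = (W_u × W_v)/|W_u × W_v|` of a surface `W`. -/
def surfn (W : ℝ × ℝ → E3) (p : ℝ × ℝ) : E3 :=
  ‖cross3 (pu W p) (pv W p)‖⁻¹ • cross3 (pu W p) (pv W p)

/-- Coefficient `L = ⟨W_uu, n⟩` of the second fundamental form. -/
def surfL (W : ℝ × ℝ → E3) (p : ℝ × ℝ) : ℝ := ⟪pu (pu W) p, surfn W p⟫

/-- Coefficient `M = ⟨W_uv, n⟩` of the second fundamental form. -/
def surfM (W : ℝ × ℝ → E3) (p : ℝ × ℝ) : ℝ := ⟪pv (pu W) p, surfn W p⟫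

/-- Coefficient `N = ⟨W_vv, n⟩` of the second fundamental form. -/
def surfN (W : ℝ × ℝ → E3) (p : ℝ × ℝ) : ℝ := ⟪pv (pv W) p, surfn W p⟫

/-- Gaussian curvature of a surface `W`. -/
def gaussK (W : ℝ × ℝ → E3) (p : ℝ × ℝ) : ℝ :=
  (surfL W p * surfN W p - (surfM W p) ^ 2) /
    (surfE W p * surfG W p - (surfF W p) ^ 2)

/-- Mean curvature of a surface `W` (w.r.t. the unit normal `surfn W`). -/
def meanH (W : ℝ × ℝ → E3) (p : ℝ × ℝ) : ℝ :=
  (surfE W p * surfN W p - 2 * surfF W p * surfM W p + surfG W p * surfL W p) /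
    (2 * (surfE W p * surfG W p - (surfF W p) ^ 2))


section PartialDerivatives

variable {E : Type*} [NormedAddCommGroup E] [NormedSpace ℝ E]

theorem contDiffAt_pu {g : ℝ × ℝ → E} {p : ℝ × ℝ} (hg : ContDiffAt ℝ (⊤ : ℕ∞) g p) :
    ContDiffAt ℝ (⊤ : ℕ∞) (pu g) p :=
  (hg.fderiv_right (m := (⊤ : ℕ∞)) (by simp)).clm_apply contDiffAt_const

theorem contDiffAt_pv {g : ℝ × ℝ → E} {p : ℝ × ℝ} (hg : ContDiffAt ℝ (⊤ : ℕ∞) g p) :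
    ContDiffAt ℝ (⊤ : ℕ∞) (pv g) p :=
  (hg.fderiv_right (m := (⊤ : ℕ∞)) (by simp)).clm_apply contDiffAt_const

theorem pv_pu_eq_pu_pv {g : ℝ × ℝ → E} {p : ℝ × ℝ} (hg : ContDiffAt ℝ (⊤ : ℕ∞) g p) :
    pv (pu g) p = pu (pv g) p := by
  have hd : DifferentiableAt ℝ (fderiv ℝ g) p :=
    (hg.fderiv_right (m := (⊤ : ℕ∞)) (by simp)).differentiableAt (by simp)
  have hs : IsSymmSndFDerivAt ℝ g p := hg.isSymmSndFDerivAt (by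
    simpa using WithTop.coe_le_coe.2 (le_top : (2 : ℕ∞) ≤ ⊤))
  have key (x y : ℝ × ℝ) :
      fderiv ℝ (fun q => fderiv ℝ g q x) p y = fderiv ℝ (fderiv ℝ g) p y x := by
    rw [fderiv_clm_apply hd (differentiableAt_const x)]
    simp
  change fderiv ℝ (fun q => fderiv ℝ g q (1, 0)) p (0, 1)
    = fderiv ℝ (fun q => fderiv ℝ g q (0, 1)) p (1, 0)
  rw [key, key]
  exact hs.eq _ _

theorem hasDerivAt_pu {g : ℝ × ℝ → E} {a b : ℝ} (hg : DifferentiableAt ℝ g (a, b)) :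
    HasDerivAt (fun t => g (t, b)) (pu g (a, b)) a :=
  hg.hasFDerivAt.comp_hasDerivAt (f := fun t : ℝ => (t, b)) a
    ((hasDerivAt_id a).prodMk (hasDerivAt_const a b))

theorem hasDerivAt_pv {g : ℝ × ℝ → E} {a b : ℝ} (hg : DifferentiableAt ℝ g (a, b)) :
    HasDerivAt (fun t => g (a, t)) (pv g (a, b)) b :=
  hg.hasFDerivAt.comp_hasDerivAt (f := fun t : ℝ => (a, t)) b
    ((hasDerivAt_const b a).prodMk (hasDerivAt_id b))

end PartialDerivatives

section VectorAlgebra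

theorem inner_e3_eq (a b : E3) : ⟪a, b⟫ = a 0 * b 0 + a 1 * b 1 + a 2 * b 2 := by
  simp only [PiLp.inner_apply, Fin.sum_univ_three, RCLike.inner_apply, conj_trivial]
  ring

theorem norm_cross3_sq (a b : E3) :
    ‖cross3 a b‖ ^ 2 = ‖a‖ ^ 2 * ‖b‖ ^ 2 - ⟪a, b⟫ ^ 2 := by
  simp only [← real_inner_self_eq_norm_sq, inner_e3_eq, cross3, e3, WithLp.equiv_symm_apply,
    Matrix.cons_val]
  ring

theorem inner_cross3_right_self (a b : E3) : ⟪b, cross3 a b⟫ = 0 := by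
  simp only [inner_e3_eq, cross3, e3, WithLp.equiv_symm_apply, Matrix.cons_val]
  ring

theorem det3_cross3 (a b c : E3) :
    det3 a c (cross3 a b) = ‖a‖ ^ 2 * ⟪c, b⟫ - ⟪a, b⟫ * ⟪c, a⟫ := by
  simp only [det3, ← real_inner_self_eq_norm_sq, inner_e3_eq, cross3, e3,
    WithLp.equiv_symm_apply, Matrix.cons_val]
  ring

theorem det3_smul_right (a b c : E3) (r : ℝ) : det3 a b (r • c) = r * det3 a b c := by
  simp only [det3, inner_e3_eq, cross3, e3, WithLp.equiv_symm_apply, Matrix.cons_val,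
    PiLp.smul_apply, smul_eq_mul]
  ring

/-- Expansion of an inner product in the frame `a, b, a × b`. -/
theorem norm_cross3_sq_mul_inner (a b c w : E3) :
    ‖cross3 a b‖ ^ 2 * ⟪c, w⟫ =
      (‖b‖ ^ 2 * ⟪a, w⟫ - ⟪a, b⟫ * ⟪b, w⟫) * ⟪c, a⟫ +
      (‖a‖ ^ 2 * ⟪b, w⟫ - ⟪a, b⟫ * ⟪a, w⟫) * ⟪c, b⟫ +
      ⟪cross3 a b, w⟫ * ⟪c, cross3 a b⟫ := by
  simp only [← real_inner_self_eq_norm_sq, inner_e3_eq, cross3, e3, WithLp.equiv_symm_apply,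
    Matrix.cons_val]
  ring

end VectorAlgebra

theorem rpow_three_quarters_sq {x : ℝ} (hx : 0 ≤ x) :
    ((x ^ 2) ^ ((3 : ℝ) / 4)) ^ 2 = x ^ 3 := by
  rw [← Real.rpow_two x, ← Real.rpow_mul hx, ← Real.rpow_natCast, ← Real.rpow_mul hx,
    ← Real.rpow_natCast x 3]
  norm_num

/-- The smaller root of `v D x² - A x + K`, in the form that stays bounded as `v → 0`. -/
theorem bounded_root_eq {A D K v : ℝ} (hA : 0 < A) (hdisc : 0 ≤ A ^ 2 - 4 * v * D * K) :
    v * D * (2 * K / (A + √(A ^ 2 - 4 * v * D * K))) ^ 2 -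
      A * (2 * K / (A + √(A ^ 2 - 4 * v * D * K))) + K = 0 := by
  have hs := Real.sq_sqrt hdisc
  have hs0 := Real.sqrt_nonneg (A ^ 2 - 4 * v * D * K)
  generalize √(A ^ 2 - 4 * v * D * K) = B at hs hs0
  have hne : A + B ≠ 0 := by positivity
  field_simp
  linear_combination K * hs

/-- a point `p = (u₀,0)` on the u-axis is a sub-parabolic point
(`Ṽκ(p) = 0` for the extended principal vector field `Ṽ`) iff
`4κ_t(u₀)² + κ_s(u₀)κ_c(u₀)² = 0`. -/
theorem stmt0
    (U : Set (ℝ × ℝ)) (hU : IsOpen U)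
    (f ν h : ℝ × ℝ → E3)
    (hf : ContDiffOn ℝ (⊤ : ℕ∞) f U) (hν : ContDiffOn ℝ (⊤ : ℕ∞) ν U) (hhsm : ContDiffOn ℝ (⊤ : ℕ∞) h U)
    (hax : ∃ p ∈ U, p.2 = (0 : ℝ))
    (hν1 : ∀ p ∈ U, ‖ν p‖ = 1)
    (ho1 : ∀ p ∈ U, (⟪pu f p, ν p⟫ : ℝ) = 0)
    (ho2 : ∀ p ∈ U, (⟪pv f p, ν p⟫ : ℝ) = 0)
    (hfront : ∀ p ∈ U, Function.Injective ⇑(fderiv ℝ (fun q => (f q, ν q)) p))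
    (hlam : ∀ p ∈ U, (lam f ν p = 0 ↔ p.2 = 0))
    (hh0 : ∀ p ∈ U, h p ≠ 0)
    (hfv : ∀ p ∈ U, pv f p = p.2 • h p)
    (hνdef : ∀ p ∈ U, ν p = ‖cross3 (pu f p) (h p)‖⁻¹ • cross3 (pu f p) (h p))
    (hNpos : ∀ p ∈ U, p.2 = 0 → 0 < Ntil ν h p)
    (u₀ : ℝ) (hp : ((u₀, 0) : ℝ × ℝ) ∈ U) :
    ((u₀, (0:ℝ)).2 * (lam f ν (u₀, 0) * Mtil ν h (u₀, 0) - kaphat f ν h (u₀, 0) * Ftil f h (u₀, 0)))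
        * pu (kap f ν h) (u₀, 0)
      + (-(lam f ν (u₀, 0) * Ltil f ν (u₀, 0)) + kaphat f ν h (u₀, 0) * Etil f (u₀, 0))
        * pv (kap f ν h) (u₀, 0) = 0 ↔
    4 * (kappat f ν h u₀) ^ 2 + kappas f ν u₀ * (kappac f ν h u₀) ^ 2 = 0 := by
  have cf {q : ℝ × ℝ} (hq : q ∈ U) := hf.contDiffAt (hU.mem_nhds hq)
  have cν {q : ℝ × ℝ} (hq : q ∈ U) := hν.contDiffAt (hU.mem_nhds hq)
  have ch := hhsm.contDiffAt (hU.mem_nhds hp)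
  have df {q : ℝ × ℝ} (hq : q ∈ U) : DifferentiableAt ℝ (pu f) q :=
    (contDiffAt_pu (cf hq)).differentiableAt (by simp)
  have dν {q : ℝ × ℝ} (hq : q ∈ U) : DifferentiableAt ℝ ν q :=
    (cν hq).differentiableAt (by simp)
  have dνu : DifferentiableAt ℝ (pu ν) (u₀, 0) :=
    (contDiffAt_pu (cν hp)).differentiableAt (by simp)
  have dνv : DifferentiableAt ℝ (pv ν) (u₀, 0) :=
    (contDiffAt_pv (cν hp)).differentiableAt (by simp)
  have dh : DifferentiableAt ℝ h (u₀, 0) := ch.differentiableAt (by simp)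
  have mem_u (a : ℝ) (ha : (a, (0 : ℝ)) ∈ U) : ∀ᶠ t in nhds a, (t, (0 : ℝ)) ∈ U :=
    (Continuous.prodMk_left (0 : ℝ)).continuousAt.eventually (hU.mem_nhds ha)
  have mem_v (a : ℝ) (ha : (a, (0 : ℝ)) ∈ U) : ∀ᶠ t in nhds (0 : ℝ), (a, t) ∈ U :=
    (Continuous.prodMk_right a).continuousAt.eventually (hU.mem_nhds ha)
  -- first derivatives along the singular curve
  have fuv (a : ℝ) (ha : (a, (0 : ℝ)) ∈ U) : pv (pu f) (a, 0) = 0 := by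
    rw [pv_pu_eq_pu_pv (cf ha)]
    refine (hasDerivAt_pu ((contDiffAt_pv (cf ha)).differentiableAt (by simp))).unique
      ((hasDerivAt_const a (0 : E3)).congr_of_eventuallyEq ?_)
    filter_upwards [mem_u a ha] with t ht
    simp [hfv _ ht]
  have fu_νv (a : ℝ) (ha : (a, (0 : ℝ)) ∈ U) : ⟪pu f (a, 0), pv ν (a, 0)⟫ = 0 := by
    have h1 := (hasDerivAt_pv (df ha)).inner ℝ (hasDerivAt_pv (dν ha))
    have h2 := h1.unique ((hasDerivAt_const 0 (0 : ℝ)).congr_of_eventuallyEq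
      ((mem_v a ha).mono fun t ht => ho1 _ ht))
    simpa [fuv a ha] using h2
  have fuu_νv : ⟪pu (pu f) (u₀, 0), pv ν (u₀, 0)⟫ = -⟪pu f (u₀, 0), pv (pu ν) (u₀, 0)⟫ := by
    have h1 := (hasDerivAt_pu (df hp)).inner ℝ (hasDerivAt_pu dνv)
    have h2 := h1.unique ((hasDerivAt_const u₀ (0 : ℝ)).congr_of_eventuallyEq
      ((mem_u u₀ hp).mono fun t ht => fu_νv t ht))
    rw [pv_pu_eq_pu_pv (cν hp)]
    linarith
  have ν_νv : ⟪ν (u₀, 0), pv ν (u₀, 0)⟫ = 0 := by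
    have h1 := (hasDerivAt_pv (dν hp)).inner ℝ (hasDerivAt_pv (dν hp))
    have h2 := h1.unique ((hasDerivAt_const 0 (1 : ℝ)).congr_of_eventuallyEq
      ((mem_v u₀ hp).mono fun t ht => by simp [hν1 _ ht]))
    rw [real_inner_comm (ν (u₀, 0)) (pv ν (u₀, 0))] at h2
    linarith
  -- nondegeneracy
  have hd : 0 < ‖cross3 (pu f (u₀, 0)) (h (u₀, 0))‖ := by
    refine norm_pos_iff.2 fun h0 => ?_
    have h1 := hν1 _ hp
    rw [hνdef _ hp, h0] at h1
    simp at h1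
  have hD := norm_cross3_sq (pu f (u₀, 0)) (h (u₀, 0))
  have hn : 0 < ‖pu f (u₀, 0)‖ := by
    refine norm_pos_iff.2 fun h0 => ?_
    rw [h0] at hD
    simp at hD
    exact hd.ne' (by simp [h0, hD])
  have hN := hNpos _ hp rfl
  -- `L̃_v` in terms of the singular curvature
  have hLv : ‖cross3 (pu f (u₀, 0)) (h (u₀, 0))‖ * ⟪pu (pu f) (u₀, 0), pv ν (u₀, 0)⟫ =
      -(Ntil ν h (u₀, 0) * det3 (pu f (u₀, 0)) (pu (pu f) (u₀, 0)) (ν (u₀, 0))) := by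
    have h1 := norm_cross3_sq_mul_inner (pu f (u₀, 0)) (h (u₀, 0)) (pu (pu f) (u₀, 0))
      (pv ν (u₀, 0))
    have h2 : ⟪cross3 (pu f (u₀, 0)) (h (u₀, 0)), pv ν (u₀, 0)⟫ = 0 := by
      have := ν_νv
      rw [hνdef _ hp, real_inner_smul_left] at this
      exact (mul_eq_zero.1 this).resolve_left (by positivity)
    rw [h2, fu_νv _ hp] at h1
    rw [hνdef _ hp, det3_smul_right, det3_cross3, Ntil]
    field_simp
    linear_combination h1
  -- smoothness of the coefficient functions
  have dE : DifferentiableAt ℝ (Etil f) (u₀, 0) := (df hp).norm_sq ℝ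
  have dF : DifferentiableAt ℝ (Ftil f h) (u₀, 0) := (df hp).inner ℝ dh
  have dG : DifferentiableAt ℝ (Gtil h) (u₀, 0) := dh.norm_sq ℝ
  have dL : DifferentiableAt ℝ (Ltil f ν) (u₀, 0) := ((df hp).inner ℝ dνu).neg
  have dM : DifferentiableAt ℝ (Mtil ν h) (u₀, 0) := (dh.inner ℝ dνu).neg
  have dN : DifferentiableAt ℝ (Ntil ν h) (u₀, 0) := (dh.inner ℝ dνv).neg
  have dA : DifferentiableAt ℝ (Atil f ν h) (u₀, 0) := by unfold Atil; fun_prop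
  have hA : 0 < Atil f ν h (u₀, 0) := by
    simp only [Atil, Etil]
    simp
    positivity
  have dK : DifferentiableAt ℝ (fun p => Ltil f ν p * Ntil ν h p - p.2 * Mtil ν h p ^ 2)
      (u₀, 0) := by fun_prop
  have ddisc : DifferentiableAt ℝ (fun p => Atil f ν h p ^ 2 -
      4 * p.2 * (Etil f p * Gtil h p - Ftil f h p ^ 2) *
        (Ltil f ν p * Ntil ν h p - p.2 * Mtil ν h p ^ 2)) (u₀, 0) := by fun_prop
  have hdisc : 0 < Atil f ν h (u₀, 0) ^ 2 -
      4 * (u₀, (0 : ℝ)).2 * (Etil f (u₀, 0) * Gtil h (u₀, 0) - Ftil f h (u₀, 0) ^ 2) *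
        (Ltil f ν (u₀, 0) * Ntil ν h (u₀, 0) - (u₀, (0 : ℝ)).2 * Mtil ν h (u₀, 0) ^ 2) := by
    simp
    positivity
  have dB : DifferentiableAt ℝ (Btil f ν h) (u₀, 0) := ddisc.sqrt hdisc.ne'
  have hAB : 0 < Atil f ν h (u₀, 0) + Btil f ν h (u₀, 0) :=
    add_pos_of_pos_of_nonneg hA (Real.sqrt_nonneg _)
  have dkap : DifferentiableAt ℝ (kap f ν h) (u₀, 0) := by
    have := (dK.const_mul 2).fun_mul ((dA.fun_add dB).fun_inv hAB.ne')
    simp only [← div_eq_mul_inv] at this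
    exact this
  -- differentiate the quadratic equation of `κ` in `v`
  have hquad : ∀ᶠ t in nhds (0 : ℝ),
      t * (Etil f (u₀, t) * Gtil h (u₀, t) - Ftil f h (u₀, t) ^ 2) * kap f ν h (u₀, t) ^ 2 -
        (Etil f (u₀, t) * Ntil ν h (u₀, t) - 2 * t * Ftil f h (u₀, t) * Mtil ν h (u₀, t) +
          t * Gtil h (u₀, t) * Ltil f ν (u₀, t)) * kap f ν h (u₀, t) +
        (Ltil f ν (u₀, t) * Ntil ν h (u₀, t) - t * Mtil ν h (u₀, t) ^ 2) = 0 := by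
    have hc : ContinuousAt (fun t : ℝ => (u₀, t)) 0 := (Continuous.prodMk_right u₀).continuousAt
    filter_upwards [hc.eventually (dA.continuousAt.eventually (lt_mem_nhds hA)),
      hc.eventually (ddisc.continuousAt.eventually (lt_mem_nhds hdisc))] with t h1 h2
    exact bounded_root_eq h1 h2.le
  have eE : HasDerivAt (fun t => Etil f (u₀, t)) 0 0 := by
    have := (hasDerivAt_pv (df hp)).norm_sq
    rw [fuv _ hp, inner_zero_right, mul_zero] at this
    exact this
  have eL : HasDerivAt (fun t => Ltil f ν (u₀, t)) ⟪pu (pu f) (u₀, 0), pv ν (u₀, 0)⟫ 0 := by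
    have := ((hasDerivAt_pv (df hp)).inner ℝ (hasDerivAt_pv dνu)).neg
    rw [fuv _ hp, inner_zero_left, add_zero, ← fuu_νv] at this
    exact this
  have eF := hasDerivAt_pv dF
  have eG := hasDerivAt_pv dG
  have eM := hasDerivAt_pv dM
  have eN := hasDerivAt_pv dN
  have ek := hasDerivAt_pv dkap
  have et := hasDerivAt_id (0 : ℝ)
  have hder := (((((et.mul ((eE.mul eG).sub (eF.pow 2))).mul (ek.pow 2)).sub
    ((((eE.mul eN).sub (((et.const_mul 2).mul eF).mul eM)).add
      ((et.mul eG).mul eL)).mul ek)).add ((eL.mul eN).sub (et.mul (eM.pow 2)))).unique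
    ((hasDerivAt_const 0 (0 : ℝ)).congr_of_eventuallyEq hquad))
  have hE : Etil f (u₀, 0) = ‖pu f (u₀, 0)‖ ^ 2 := rfl
  have hkap : kap f ν h (u₀, 0) = Ltil f ν (u₀, 0) / ‖pu f (u₀, 0)‖ ^ 2 := by
    have := hquad.self_of_nhds
    rw [hE] at this
    field_simp
    simp at this
    refine mul_left_cancel₀ hN.ne' ?_
    linear_combination -this
  have hDE : Etil f (u₀, 0) * Gtil h (u₀, 0) - Ftil f h (u₀, 0) ^ 2 =
    ‖cross3 (pu f (u₀, 0)) (h (u₀, 0))‖ ^ 2 := hD.symm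
  have hkh : kaphat f ν h (u₀, 0) ≠ 0 := by unfold kaphat; positivity
  simp only [zero_mul, zero_add]
  have hlam0 : lam f ν (u₀, 0) = 0 := (hlam _ hp).2 rfl
  rw [hlam0, zero_mul, neg_zero, zero_add, mul_eq_zero_iff_left (mul_ne_zero hkh (by
    rw [hE]; positivity))]
  have hkc : kappac f ν h u₀ ^ 2 = 4 * ‖pu f (u₀, 0)‖ ^ 3 * Ntil ν h (u₀, 0) ^ 2 /
      ‖cross3 (pu f (u₀, 0)) (h (u₀, 0))‖ ^ 3 := by
    rw [kappac, hDE, hE, div_pow, mul_pow, mul_pow, rpow_three_quarters_sq hn.le,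
      rpow_three_quarters_sq hd.le]
    norm_num
  rw [hkc, kappat, hDE, Real.sqrt_sq hd.le, kappas]
  simp at hder
  rw [hkap] at hder
  rw [hE] at hder ⊢
  clear hkc hkh hlam0 hkap hdisc hDE hquad hAB hA hD
  generalize ‖cross3 (pu f (u₀, 0)) (h (u₀, 0))‖ = d at *
  generalize ‖pu f (u₀, 0)‖ = n at *
  generalize det3 (pu f (u₀, 0)) (pu (pu f) (u₀, 0)) (ν (u₀, 0)) = S at *
  generalize ⟪pu (pu f) (u₀, 0), pv ν (u₀, 0)⟫ = Lv at *
  generalize pv (kap f ν h) (u₀, 0) = k at *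
  generalize Ltil f ν (u₀, 0) = L at *
  generalize Mtil ν h (u₀, 0) = M at *
  generalize Ntil ν h (u₀, 0) = N at *
  generalize Ftil f h (u₀, 0) = F at *
  have hLv' : Lv = -(N * S) / d := by
    field_simp
    linear_combination hLv
  have hk : n ^ 2 * N * k = -((n ^ 2 * M - F * L) / n ^ 2) ^ 2 - N ^ 2 * S / d := by
    rw [hLv'] at hder
    field_simp at hder ⊢
    linear_combination -hder
  have hfin : 4 * ((n ^ 2 * M - F * L) / (n ^ 2 * d)) ^ 2 +
      S / n ^ 3 * (4 * n ^ 3 * N ^ 2 / d ^ 3) = -(4 / d ^ 2) * (n ^ 2 * N) * k := by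
    rw [mul_assoc (-_), hk]
    field_simp
    ring
  rw [hfin, mul_eq_zero_iff_left]
  have : 0 < 4 / d ^ 2 * (n ^ 2 * N) := by positivity
  linarith
end
end

section
/- Under the general front setting with a non-degenerate singular point p, a C^∞ principal curvature κ with κ(p) ≠ 0 and F(u,v,w) = f(u,v) + w·ν(u,v): the point P = (p, 1/κ(p)) is a corank one singular point of F, i.e. the differential dF at P has rank exactly 2; moreover there is a neighborhood W of P in U×ℝ such that {(u,v,w) ∈ W : 1 − w·κ(u,v) = 0} is a 2-dimensional C^∞ submanifold of ℝ³ (a smooth codimension-one submanifold of U×ℝ). -/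
noncomputable section

local notation "⟪" x ", " y "⟫" => @inner ℝ _ _ x y

/-- `L = −⟨f_u, ν_u⟩`. -/
def Lff (f ν : ℝ × ℝ → E3) (p : ℝ × ℝ) : ℝ := -⟪pu f p, pu ν p⟫

/-- `M = −⟨f_u, ν_v⟩`. -/
def Mff (f ν : ℝ × ℝ → E3) (p : ℝ × ℝ) : ℝ := -⟪pu f p, pv ν p⟫

/-- `N = −⟨f_v, ν_v⟩`. -/
def Nff (f ν : ℝ × ℝ → E3) (p : ℝ × ℝ) : ℝ := -⟪pv f p, pv ν p⟫

/-- Gaussian curvature `K = (LN−M²)/(EG−F²)` of the front `f` (away from singularities). -/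
def Kff (f ν : ℝ × ℝ → E3) (p : ℝ × ℝ) : ℝ :=
  (Lff f ν p * Nff f ν p - (Mff f ν p) ^ 2) /
    (‖pu f p‖ ^ 2 * ‖pv f p‖ ^ 2 - (⟪pu f p, pv f p⟫ : ℝ) ^ 2)

/-- Mean curvature `H = (EN−2FM+GL)/(2(EG−F²))` of the front `f` (away from singularities). -/
def Hff (f ν : ℝ × ℝ → E3) (p : ℝ × ℝ) : ℝ :=
  (‖pu f p‖ ^ 2 * Nff f ν p - 2 * (⟪pu f p, pv f p⟫ : ℝ) * Mff f ν p +
      ‖pv f p‖ ^ 2 * Lff f ν p) /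
    (2 * (‖pu f p‖ ^ 2 * ‖pv f p‖ ^ 2 - (⟪pu f p, pv f p⟫ : ℝ) ^ 2))

/-- The map `F(u,v,w) = f(u,v) + w·ν(u,v)`. -/
def bigF (f ν : ℝ × ℝ → E3) (P : (ℝ × ℝ) × ℝ) : E3 := f P.1 + P.2 • ν P.1

/-- Directional derivative of the function `g` along the vector field `V = (V₁, V₂)`. -/
def dirD (V₁ V₂ : ℝ × ℝ → ℝ) (g : ℝ × ℝ → ℝ) (q : ℝ × ℝ) : ℝ :=
  V₁ q * pu g q + V₂ q * pv g q

/-- `A`-equivalence of the map germ of `f` at `p` with the map germ of `g` at `q`: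
there are germs of `C^∞` diffeomorphisms `θ` of the source with `θ(p) = q` and `Θ` of the
target with `Θ(f(p)) = g(q)` such that `Θ ∘ f = g ∘ θ` near `p`. -/
def AEquivAt {A B : Type*} [NormedAddCommGroup A] [NormedSpace ℝ A]
    [NormedAddCommGroup B] [NormedSpace ℝ B]
    (f : A → B) (p : A) (g : A → B) (q : A) : Prop :=
  ∃ (θ : PartialHomeomorph A A) (Θ : PartialHomeomorph B B),
    p ∈ θ.source ∧ θ p = q ∧
    ContDiffOn ℝ (⊤ : ℕ∞) (⇑θ) θ.source ∧ ContDiffOn ℝ (⊤ : ℕ∞) (⇑θ.symm) θ.target ∧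
    f p ∈ Θ.source ∧ Θ (f p) = g q ∧
    ContDiffOn ℝ (⊤ : ℕ∞) (⇑Θ) Θ.source ∧ ContDiffOn ℝ (⊤ : ℕ∞) (⇑Θ.symm) Θ.target ∧
    ∀ x ∈ θ.source, Θ (f x) = g (θ x)


lemma inner_eq_sum_coords (a b : E3) : (⟪a, b⟫ : ℝ) = a 0 * b 0 + a 1 * b 1 + a 2 * b 2 := by
  simp only [PiLp.inner_apply, RCLike.inner_apply, conj_trivial, Fin.sum_univ_three]
  ring

lemma det3_eq_coords (a b c : E3) :
    det3 a b c = a 0 * (b 1 * c 2 - b 2 * c 1) + a 1 * (b 2 * c 0 - b 0 * c 2) +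
      a 2 * (b 0 * c 1 - b 1 * c 0) := by
  rw [det3, inner_eq_sum_coords]
  simp [cross3, e3]

/-- The Gram identity for two triples sharing a third vector orthogonal to `a` and `b`. -/
lemma det3_mul_det3 {a b n : E3} (x y : E3) (hn : ‖n‖ = 1) (ha : (⟪a, n⟫ : ℝ) = 0)
    (hb : (⟪b, n⟫ : ℝ) = 0) :
    det3 a b n * det3 x y n = (⟪a, x⟫ : ℝ) * ⟪b, y⟫ - (⟪a, y⟫ : ℝ) * ⟪b, x⟫ := by
  have hnn : (⟪n, n⟫ : ℝ) = 1 := by rw [real_inner_self_eq_norm_sq, hn, one_pow]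
  have gram : det3 a b n * det3 x y n =
      (⟪a, x⟫ : ℝ) * ((⟪b, y⟫ : ℝ) * ⟪n, n⟫ - (⟪b, n⟫ : ℝ) * ⟪n, y⟫)
      - (⟪a, y⟫ : ℝ) * ((⟪b, x⟫ : ℝ) * ⟪n, n⟫ - (⟪b, n⟫ : ℝ) * ⟪n, x⟫)
      + (⟪a, n⟫ : ℝ) * ((⟪b, x⟫ : ℝ) * ⟪n, y⟫ - (⟪b, y⟫ : ℝ) * ⟪n, x⟫) := by
    simp only [det3_eq_coords, inner_eq_sum_coords]
    ring
  rw [gram, hnn, ha, hb]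
  ring

/-- A vanishing Gram determinant yields a linear relation. -/
lemma exists_linear_relation {a b : E3} (h : ‖a‖ ^ 2 * ‖b‖ ^ 2 - (⟪a, b⟫ : ℝ) ^ 2 = 0) :
    ∃ s t : ℝ, (s, t) ≠ 0 ∧ s • a + t • b = 0 := by
  by_cases ha : a = 0
  · exact ⟨1, 0, by simp, by simp [ha]⟩
  · refine ⟨-⟪a, b⟫, ‖a‖ ^ 2, ?_, ?_⟩
    · simp [ha]
    · rw [← norm_eq_zero, ← sq_eq_zero_iff, ← real_inner_self_eq_norm_sq]
      simp only [inner_add_left, inner_add_right, real_inner_smul_left, real_inner_smul_right]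
      rw [real_inner_self_eq_norm_sq, real_inner_self_eq_norm_sq, real_inner_comm a b]
      linear_combination ‖a‖ ^ 2 * h

lemma exists_orthogonal_of_det3_eq_zero {a b c : E3} (h : det3 a b c = 0) :
    ∃ x : E3, x ≠ 0 ∧ (⟪a, x⟫ : ℝ) = 0 ∧ (⟪b, x⟫ : ℝ) = 0 ∧ (⟪c, x⟫ : ℝ) = 0 := by
  have hdet : (Matrix.of ![⇑a, ⇑b, ⇑c] : Matrix (Fin 3) (Fin 3) ℝ).det = 0 := by
    rw [← h, det3_eq_coords, Matrix.det_fin_three]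
    simp
    ring
  obtain ⟨v, hv, hMv⟩ := Matrix.exists_mulVec_eq_zero_iff.mpr hdet
  refine ⟨WithLp.toLp 2 v, by simpa using hv, ?_, ?_, ?_⟩
  · simpa [inner_eq_sum_coords, Matrix.mulVec, dotProduct, Fin.sum_univ_three] using congrFun hMv 0
  · simpa [inner_eq_sum_coords, Matrix.mulVec, dotProduct, Fin.sum_univ_three] using congrFun hMv 1
  · simpa [inner_eq_sum_coords, Matrix.mulVec, dotProduct, Fin.sum_univ_three] using congrFun hMv 2

lemma continuousAt_det3 {X : Type*} [TopologicalSpace X] {a b c : X → E3} {x : X}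
    (ha : ContinuousAt a x) (hb : ContinuousAt b x) (hc : ContinuousAt c x) :
    ContinuousAt (fun y => det3 (a y) (b y) (c y)) x := by
  simp only [det3_eq_coords]
  fun_prop

lemma fderiv_prod_apply_eq {E : Type*} [NormedAddCommGroup E] [NormedSpace ℝ E]
    (g : ℝ × ℝ → E) (q : ℝ × ℝ) (s t : ℝ) :
    fderiv ℝ g q (s, t) = s • pu g q + t • pv g q := by
  rw [pu, pv, ← map_smul, ← map_smul, ← map_add]
  simp

lemma inner_fderiv_of_norm_eq_one {U : Set (ℝ × ℝ)} (hU : IsOpen U) {ν : ℝ × ℝ → E3}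
    (hν : ContDiffOn ℝ (⊤ : ℕ∞) ν U) (hν1 : ∀ q ∈ U, ‖ν q‖ = 1) {q : ℝ × ℝ} (hq : q ∈ U)
    (e : ℝ × ℝ) : (⟪fderiv ℝ ν q e, ν q⟫ : ℝ) = 0 := by
  have hd : DifferentiableAt ℝ ν q := (hν.contDiffAt (hU.mem_nhds hq)).differentiableAt (by simp)
  have hc : (fun x => (⟪ν x, ν x⟫ : ℝ)) =ᶠ[nhds q] fun _ => 1 := by
    filter_upwards [hU.mem_nhds hq] with x hx
    rw [real_inner_self_eq_norm_sq, hν1 x hx, one_pow]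
  have h := congrArg (fun T : ℝ × ℝ →L[ℝ] ℝ => T e) hc.fderiv_eq
  simp only [fderiv_inner_apply ℝ hd hd, fderiv_fun_const, Pi.zero_apply,
    zero_apply] at h
  rw [real_inner_comm] at h
  linarith

lemma inner_second_fderiv_of_orthogonal {U : Set (ℝ × ℝ)} (hU : IsOpen U) {f ν : ℝ × ℝ → E3}
    (hf : ContDiffOn ℝ (⊤ : ℕ∞) f U) (hν : ContDiffOn ℝ (⊤ : ℕ∞) ν U) (e d : ℝ × ℝ)
    (ho : ∀ q ∈ U, (⟪fderiv ℝ f q e, ν q⟫ : ℝ) = 0) {q : ℝ × ℝ} (hq : q ∈ U) :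
    (⟪fderiv ℝ f q e, fderiv ℝ ν q d⟫ : ℝ) = -⟪fderiv ℝ (fderiv ℝ f) q d e, ν q⟫ := by
  have hd : DifferentiableAt ℝ ν q := (hν.contDiffAt (hU.mem_nhds hq)).differentiableAt (by simp)
  have hf2 : DifferentiableAt ℝ (fderiv ℝ f) q :=
    ((hf.contDiffAt (hU.mem_nhds hq)).fderiv_right (m := 1) (by norm_cast)).differentiableAt
      (by simp)
  have hfe : DifferentiableAt ℝ (fun x => fderiv ℝ f x e) q :=
    hf2.clm_apply (differentiableAt_const e)
  have hc : (fun x => (⟪fderiv ℝ f x e, ν x⟫ : ℝ)) =ᶠ[nhds q] fun _ => 0 := by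
    filter_upwards [hU.mem_nhds hq] with x hx using ho x hx
  have h := congrArg (fun T : ℝ × ℝ →L[ℝ] ℝ => T d) hc.fderiv_eq
  simp only [fderiv_inner_apply ℝ hfe hd, fderiv_fun_const, Pi.zero_apply,
    zero_apply, fderiv_clm_apply hf2 (differentiableAt_const e)] at h
  simp at h
  linarith

/-- Symmetry of the second fundamental form. -/
lemma inner_pv_pu_eq {U : Set (ℝ × ℝ)} (hU : IsOpen U) {f ν : ℝ × ℝ → E3}
    (hf : ContDiffOn ℝ (⊤ : ℕ∞) f U) (hν : ContDiffOn ℝ (⊤ : ℕ∞) ν U)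
    (ho1 : ∀ q ∈ U, (⟪pu f q, ν q⟫ : ℝ) = 0) (ho2 : ∀ q ∈ U, (⟪pv f q, ν q⟫ : ℝ) = 0)
    {q : ℝ × ℝ} (hq : q ∈ U) : (⟪pv f q, pu ν q⟫ : ℝ) = ⟪pu f q, pv ν q⟫ := by
  have hs : IsSymmSndFDerivAt ℝ f q :=
    (hf.contDiffAt (hU.mem_nhds hq)).isSymmSndFDerivAt (by simp; norm_cast)
  rw [pu, pv, pu, pv, inner_second_fderiv_of_orthogonal hU hf hν _ _ ho1 hq,
    inner_second_fderiv_of_orthogonal hU hf hν _ _ ho2 hq, hs.eq]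

lemma lam_sq {f ν : ℝ × ℝ → E3} {q : ℝ × ℝ} (hν1 : ‖ν q‖ = 1)
    (ho1 : (⟪pu f q, ν q⟫ : ℝ) = 0) (ho2 : (⟪pv f q, ν q⟫ : ℝ) = 0) :
    lam f ν q ^ 2 = ‖pu f q‖ ^ 2 * ‖pv f q‖ ^ 2 - (⟪pu f q, pv f q⟫ : ℝ) ^ 2 := by
  rw [sq, lam, det3_mul_det3 _ _ hν1 ho1 ho2, real_inner_self_eq_norm_sq,
    real_inner_self_eq_norm_sq, real_inner_comm (pu f q) (pv f q), sq (inner ℝ _ _)]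

lemma det3_principal_eq_zero {f ν : ℝ × ℝ → E3} {q : ℝ × ℝ} {k : ℝ} (hν1 : ‖ν q‖ = 1)
    (ho1 : (⟪pu f q, ν q⟫ : ℝ) = 0) (ho2 : (⟪pv f q, ν q⟫ : ℝ) = 0)
    (hsymm : (⟪pv f q, pu ν q⟫ : ℝ) = ⟪pu f q, pv ν q⟫) (hl : lam f ν q ≠ 0)
    (hk : k ^ 2 - 2 * Hff f ν q * k + Kff f ν q = 0) :
    det3 (k • pu f q + pu ν q) (k • pv f q + pv ν q) (ν q) = 0 := by
  have hA : ‖pu f q‖ ^ 2 * ‖pv f q‖ ^ 2 - (⟪pu f q, pv f q⟫ : ℝ) ^ 2 ≠ 0 := by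
    rw [← lam_sq hν1 ho1 ho2]
    exact pow_ne_zero 2 hl
  refine (mul_eq_zero.mp ?_).resolve_left hl
  rw [lam, det3_mul_det3 _ _ hν1 ho1 ho2]
  simp only [inner_add_right, real_inner_smul_right, real_inner_self_eq_norm_sq, hsymm,
    real_inner_comm (pu f q) (pv f q)]
  rw [Hff, Kff, Lff, Mff, Nff] at hk
  field_simp at hk
  linear_combination hk

/-- At a nondegenerate singular point, the principal curvature equation persists in the form of a
linear dependence. -/
lemma det3_principal_eq_zero_at_singular {U : Set (ℝ × ℝ)} (hU : IsOpen U) {f ν : ℝ × ℝ → E3}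
    (hf : ContDiffOn ℝ (⊤ : ℕ∞) f U) (hν : ContDiffOn ℝ (⊤ : ℕ∞) ν U)
    (hν1 : ∀ q ∈ U, ‖ν q‖ = 1)
    (ho1 : ∀ q ∈ U, (⟪pu f q, ν q⟫ : ℝ) = 0) (ho2 : ∀ q ∈ U, (⟪pv f q, ν q⟫ : ℝ) = 0)
    {p : ℝ × ℝ} (hp : p ∈ U) (hnd : fderiv ℝ (lam f ν) p ≠ 0)
    {κ : ℝ × ℝ → ℝ} (hκ : ContinuousAt κ p)
    (hprin : ∀ q ∈ U, lam f ν q ≠ 0 → κ q ^ 2 - 2 * Hff f ν q * κ q + Kff f ν q = 0) :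
    det3 (κ p • pu f p + pu ν p) (κ p • pv f p + pv ν p) (ν p) = 0 := by
  have hfderiv : ∀ {g : ℝ × ℝ → E3}, ContDiffOn ℝ (⊤ : ℕ∞) g U → ∀ e,
      ContinuousAt (fun q => fderiv ℝ g q e) p := fun hg e =>
    ((hg.contDiffAt (hU.mem_nhds hp)).fderiv_right (m := 0) (by simp)).continuousAt.clm_apply
      continuousAt_const
  have hcont : ContinuousAt
      (fun q => det3 (κ q • pu f q + pu ν q) (κ q • pv f q + pv ν q) (ν q)) p :=
    continuousAt_det3 ((hκ.smul (hfderiv hf _)).add (hfderiv hν _))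
      ((hκ.smul (hfderiv hf _)).add (hfderiv hν _)) (hν.continuousOn.continuousAt (hU.mem_nhds hp))
  by_contra hne
  apply hnd
  have hzero : lam f ν =ᶠ[nhds p] fun _ => 0 := by
    filter_upwards [hcont.eventually_ne hne, hU.mem_nhds hp] with q hq hqU
    by_contra hl
    exact hq (det3_principal_eq_zero (hν1 q hqU) (ho1 q hqU) (ho2 q hqU)
      (inner_pv_pu_eq hU hf hν ho1 ho2 hqU) hl (hprin q hqU hl))
  rw [hzero.fderiv_eq, fderiv_fun_const]
  rfl

lemma fderiv_bigF_apply {f ν : ℝ × ℝ → E3} {q : ℝ × ℝ} (hf : DifferentiableAt ℝ f q)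
    (hν : DifferentiableAt ℝ ν q) (w s t r : ℝ) :
    fderiv ℝ (bigF f ν) (q, w) ((s, t), r) =
      s • (pu f q + w • pu ν q) + t • (pv f q + w • pv ν q) + r • ν q := by
  have hf' : HasFDerivAt (fun P : (ℝ × ℝ) × ℝ => f P.1)
      ((fderiv ℝ f q).comp (ContinuousLinearMap.fst ℝ (ℝ × ℝ) ℝ)) (q, w) :=
    HasFDerivAt.comp (q, w) (g := f) hf.hasFDerivAt hasFDerivAt_fst
  have hν' : HasFDerivAt (fun P : (ℝ × ℝ) × ℝ => ν P.1)
      ((fderiv ℝ ν q).comp (ContinuousLinearMap.fst ℝ (ℝ × ℝ) ℝ)) (q, w) :=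
    HasFDerivAt.comp (q, w) (g := ν) hν.hasFDerivAt hasFDerivAt_fst
  have h : HasFDerivAt (bigF f ν) _ (q, w) := hf'.add (hasFDerivAt_snd.smul hν')
  rw [h.fderiv]
  simp [fderiv_prod_apply_eq]
  module

/-- A front with both `f_u + w ν_u` and `f_v + w ν_v` vanishing is regular. -/
lemma lam_ne_zero_of_umbilic {f ν : ℝ × ℝ → E3} {q : ℝ × ℝ} {w : ℝ}
    (hf : DifferentiableAt ℝ f q) (hν : DifferentiableAt ℝ ν q) (hν1 : ‖ν q‖ = 1)
    (ho1 : (⟪pu f q, ν q⟫ : ℝ) = 0) (ho2 : (⟪pv f q, ν q⟫ : ℝ) = 0)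
    (hfront : Function.Injective ⇑(fderiv ℝ (fun x => (f x, ν x)) q)) (hw : w ≠ 0)
    (hu : pu f q + w • pu ν q = 0) (hv : pv f q + w • pv ν q = 0) : lam f ν q ≠ 0 := by
  intro hl
  obtain ⟨s, t, hst, hrel⟩ := exists_linear_relation (a := pu f q) (b := pv f q)
    (by rw [← lam_sq hν1 ho1 ho2, hl]; simp)
  refine hst (hfront ?_)
  rw [map_zero, hf.fderiv_prodMk hν, ContinuousLinearMap.prod_apply, fderiv_prod_apply_eq,
    fderiv_prod_apply_eq, hrel, Prod.mk_eq_zero]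
  refine ⟨rfl, (smul_eq_zero.mp ?_).resolve_left hw⟩
  calc w • (s • pu ν q + t • pv ν q)
      = s • (pu f q + w • pu ν q) + t • (pv f q + w • pv ν q) - (s • pu f q + t • pv f q) := by
        module
    _ = 0 := by rw [hu, hv, hrel]; simp

lemma two_le_finrank_of_orthogonal {S : Submodule ℝ E3} {a n : E3} (ha : a ∈ S) (hn : n ∈ S)
    (ha0 : a ≠ 0) (hn0 : n ≠ 0) (han : (⟪a, n⟫ : ℝ) = 0) : 2 ≤ Module.finrank ℝ S := by
  have hli : LinearIndependent ℝ ![(⟨a, ha⟩ : S), ⟨n, hn⟩] := by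
    apply LinearIndependent.of_comp S.subtype
    apply linearIndependent_of_ne_zero_of_inner_eq_zero (𝕜 := ℝ)
    · intro i; fin_cases i <;> simpa
    · intro i j hij
      fin_cases i <;> fin_cases j <;> simp_all [real_inner_comm]
  simpa using hli.fintype_card_le_finrank

lemma finrank_range_fderiv_bigF {U : Set (ℝ × ℝ)} (hU : IsOpen U) {f ν : ℝ × ℝ → E3}
    (hf : ContDiffOn ℝ (⊤ : ℕ∞) f U) (hν : ContDiffOn ℝ (⊤ : ℕ∞) ν U)
    (hν1 : ∀ q ∈ U, ‖ν q‖ = 1)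
    (ho1 : ∀ q ∈ U, (⟪pu f q, ν q⟫ : ℝ) = 0) (ho2 : ∀ q ∈ U, (⟪pv f q, ν q⟫ : ℝ) = 0)
    {p : ℝ × ℝ} (hp : p ∈ U)
    (hfront : Function.Injective ⇑(fderiv ℝ (fun x => (f x, ν x)) p)) (hsing : lam f ν p = 0)
    {k : ℝ} (hk0 : k ≠ 0)
    (hdet : det3 (k • pu f p + pu ν p) (k • pv f p + pv ν p) (ν p) = 0) :
    Module.finrank ℝ
      ↥(LinearMap.range (fderiv ℝ (bigF f ν) (p, k⁻¹)).toLinearMap) = 2 := by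
  have hfd : DifferentiableAt ℝ f p := (hf.contDiffAt (hU.mem_nhds hp)).differentiableAt (by simp)
  have hνd : DifferentiableAt ℝ ν p := (hν.contDiffAt (hU.mem_nhds hp)).differentiableAt (by simp)
  have hν0 : ν p ≠ 0 := by
    rw [← norm_ne_zero_iff, hν1 p hp]
    exact one_ne_zero
  have hF := fderiv_bigF_apply hfd hνd k⁻¹
  set T := fderiv ℝ (bigF f ν) (p, k⁻¹)
  have memu : pu f p + k⁻¹ • pu ν p ∈ LinearMap.range T.toLinearMap :=
    ⟨((1, 0), 0), by simpa using hF 1 0 0⟩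
  have memv : pv f p + k⁻¹ • pv ν p ∈ LinearMap.range T.toLinearMap :=
    ⟨((0, 1), 0), by simpa using hF 0 1 0⟩
  have memn : ν p ∈ LinearMap.range T.toLinearMap :=
    ⟨((0, 0), 1), by simpa using hF 0 0 1⟩
  have hνu : (⟪pu ν p, ν p⟫ : ℝ) = 0 := inner_fderiv_of_norm_eq_one hU hν hν1 hp _
  have hνv : (⟪pv ν p, ν p⟫ : ℝ) = 0 := inner_fderiv_of_norm_eq_one hU hν hν1 hp _
  apply le_antisymm
  · obtain ⟨x, hx0, hxu, hxv, hxn⟩ := exists_orthogonal_of_det3_eq_zero hdet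
    have hne : LinearMap.range T.toLinearMap ≠ ⊤ := by
      intro htop
      obtain ⟨⟨⟨s, t⟩, r⟩, hy⟩ : x ∈ LinearMap.range T.toLinearMap := htop ▸ Submodule.mem_top
      have hy' : x = (k⁻¹ * s) • (k • pu f p + pu ν p) + (k⁻¹ * t) • (k • pv f p + pv ν p) +
          r • ν p := by
        rw [← hy, ContinuousLinearMap.coe_coe, hF]
        simp only [smul_add, smul_smul]
        rw [mul_right_comm k⁻¹ s k, mul_right_comm k⁻¹ t k, inv_mul_cancel₀ hk0]
        simp only [one_mul, mul_comm k⁻¹]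
      apply hx0
      rw [← inner_self_eq_zero (𝕜 := ℝ)]
      nth_rewrite 1 [hy']
      simp only [inner_add_left _ _ x, real_inner_smul_left] at hxu hxv ⊢
      rw [hxn]
      linear_combination (k⁻¹ * s) * hxu + (k⁻¹ * t) * hxv
    have hlt := Submodule.finrank_lt hne
    rw [finrank_euclideanSpace_fin] at hlt
    omega
  · by_cases hu : pu f p + k⁻¹ • pu ν p = 0
    · refine two_le_finrank_of_orthogonal memv memn (fun hv => ?_) hν0 ?_
      · exact lam_ne_zero_of_umbilic hfd hνd (hν1 p hp) (ho1 p hp) (ho2 p hp) hfront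
          (inv_ne_zero hk0) hu hv hsing
      · rw [inner_add_left, real_inner_smul_left, ho2 p hp, hνv]; simp
    · refine two_le_finrank_of_orthogonal memu memn hu hν0 ?_
      rw [inner_add_left, real_inner_smul_left, ho1 p hp, hνu]; simp

/-- The zero set of `1 - w κ` is straightened by `(q, w) ↦ (q, 1 - w κ(q))` where `κ ≠ 0`. -/
lemma exists_straightening {U : Set (ℝ × ℝ)} (hU : IsOpen U) {κ : ℝ × ℝ → ℝ}
    (hκ : ContDiffOn ℝ (⊤ : ℕ∞) κ U) {p : ℝ × ℝ} (hp : p ∈ U) (hκ0 : κ p ≠ 0) (w : ℝ) :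
    ∃ W : Set ((ℝ × ℝ) × ℝ), IsOpen W ∧ (p, w) ∈ W ∧
      ∃ V : Set ((ℝ × ℝ) × ℝ), IsOpen V ∧
        ∃ ψ ψinv : (ℝ × ℝ) × ℝ → (ℝ × ℝ) × ℝ,
          ContDiffOn ℝ (⊤ : ℕ∞) ψ W ∧ ContDiffOn ℝ (⊤ : ℕ∞) ψinv V ∧ Set.BijOn ψ W V ∧
          (∀ x ∈ W, ψinv (ψ x) = x) ∧
          ψ '' (W ∩ {x : (ℝ × ℝ) × ℝ | 1 - x.2 * κ x.1 = 0}) =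
            V ∩ {x : (ℝ × ℝ) × ℝ | x.2 = 0} := by
  set W : Set ((ℝ × ℝ) × ℝ) := Prod.fst ⁻¹' (U ∩ κ ⁻¹' {0}ᶜ) with hW
  have hWopen : IsOpen W :=
    (hκ.continuousOn.isOpen_inter_preimage hU isOpen_compl_singleton).preimage continuous_fst
  have hκ1 : ContDiffOn ℝ (⊤ : ℕ∞) (fun x : (ℝ × ℝ) × ℝ => κ x.1) W :=
    hκ.comp contDiff_fst.contDiffOn fun x hx => hx.1
  have hne : ∀ x ∈ W, κ x.1 ≠ 0 := fun x hx => hx.2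
  have hleft : ∀ x ∈ W, (x.1, (1 - (1 - x.2 * κ x.1)) / κ x.1) = x := fun x hx => by
    have := hne x hx
    ext <;> simp [this]
  have hright : ∀ x ∈ W, (x.1, 1 - (1 - x.2) / κ x.1 * κ x.1) = x := fun x hx => by
    have := hne x hx
    ext <;> simp [this]
  refine ⟨W, hWopen, ⟨hp, hκ0⟩, W, hWopen, fun x => (x.1, 1 - x.2 * κ x.1),
    fun x => (x.1, (1 - x.2) / κ x.1), ?_, ?_, ?_, hleft, ?_⟩
  · exact contDiff_fst.contDiffOn.prodMk
      (contDiffOn_const.sub (contDiff_snd.contDiffOn.mul hκ1))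
  · exact contDiff_fst.contDiffOn.prodMk
      ((contDiffOn_const.sub contDiff_snd.contDiffOn).div hκ1 hne)
  · exact Set.BijOn.mk (fun x hx => hx)
      (Set.LeftInvOn.injOn (f₁' := fun x => (x.1, (1 - x.2) / κ x.1)) hleft)
      fun x hx => ⟨(x.1, (1 - x.2) / κ x.1), hx, hright x hx⟩
  · ext y
    constructor
    · rintro ⟨x, ⟨hxW, hx⟩, rfl⟩
      exact ⟨hxW, hx⟩
    · rintro ⟨hyW, hy⟩
      refine ⟨(y.1, (1 - y.2) / κ y.1), ⟨hyW, ?_⟩, hright y hyW⟩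
      exact (congrArg Prod.snd (hright y hyW)).trans hy

/-- `P = (p, 1/κ(p))` is a corank one singular point of `F` (the differential
has rank exactly 2), and near `P` the set `{1 − wκ(u,v) = 0}` is a smooth codimension-one
submanifold of `ℝ³` (it can be smoothly straightened to a piece of the plane `{w = 0}`). -/
theorem stmt4
    (U : Set (ℝ × ℝ)) (hU : IsOpen U)
    (f ν : ℝ × ℝ → E3)
    (hf : ContDiffOn ℝ (⊤ : ℕ∞) f U) (hν : ContDiffOn ℝ (⊤ : ℕ∞) ν U)
    (hν1 : ∀ q ∈ U, ‖ν q‖ = 1)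
    (ho1 : ∀ q ∈ U, (⟪pu f q, ν q⟫ : ℝ) = 0)
    (ho2 : ∀ q ∈ U, (⟪pv f q, ν q⟫ : ℝ) = 0)
    (hfront : ∀ q ∈ U, Function.Injective ⇑(fderiv ℝ (fun x => (f x, ν x)) q))
    (p : ℝ × ℝ) (hpU : p ∈ U)
    (hsing : lam f ν p = 0)
    (hnd : fderiv ℝ (lam f ν) p ≠ 0)
    (κ : ℝ × ℝ → ℝ) (hκsm : ContDiffOn ℝ (⊤ : ℕ∞) κ U) (hκ0 : κ p ≠ 0)
    (hprin : ∀ q ∈ U, lam f ν q ≠ 0 → κ q ^ 2 - 2 * Hff f ν q * κ q + Kff f ν q = 0) :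
    Module.finrank ℝ
        ↥(LinearMap.range (fderiv ℝ (bigF f ν) (p, (κ p)⁻¹)).toLinearMap) = 2 ∧
    ∃ W : Set ((ℝ × ℝ) × ℝ), IsOpen W ∧ (p, (κ p)⁻¹) ∈ W ∧
      ∃ V : Set ((ℝ × ℝ) × ℝ), IsOpen V ∧
        ∃ ψ ψinv : (ℝ × ℝ) × ℝ → (ℝ × ℝ) × ℝ,
          ContDiffOn ℝ (⊤ : ℕ∞) ψ W ∧ ContDiffOn ℝ (⊤ : ℕ∞) ψinv V ∧ Set.BijOn ψ W V ∧
          (∀ x ∈ W, ψinv (ψ x) = x) ∧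
          ψ '' (W ∩ {x : (ℝ × ℝ) × ℝ | 1 - x.2 * κ x.1 = 0}) =
            V ∩ {x : (ℝ × ℝ) × ℝ | x.2 = 0} := by
  refine ⟨finrank_range_fderiv_bigF hU hf hν hν1 ho1 ho2 hpU (hfront p hpU) hsing hκ0 ?_,
    exists_straightening hU hκsm hpU hκ0 _⟩
  exact det3_principal_eq_zero_at_singular hU hf hν hν1 ho1 ho2 hpU hnd
    (hκsm.continuousOn.continuousAt (hU.mem_nhds hpU)) hprin
end
end

section
/- Under the general front setting with a non-degenerate singular point p, a C^∞ principal curvature κ with κ(p) ≠ 0 and a principal vector field V for κ: the focal surface FC_f := f + (1/κ)·ν is an immersion at p if and only if p is not a ridge point of f, i.e. Vκ(p) ≠ 0. -/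
noncomputable section

local notation "⟪" x ", " y "⟫" => @inner ℝ _ _ x y

/-- Two vectors orthogonal to a unit vector `n` with vanishing triple product attain equality
in the Cauchy–Schwarz inequality. -/
theorem norm_sq_mul_norm_sq_eq_of_det3_eq_zero {a b n : E3} (hn : ‖n‖ = 1)
    (ha : (⟪a, n⟫ : ℝ) = 0) (hb : (⟪b, n⟫ : ℝ) = 0) (h : det3 a b n = 0) :
    (⟪a, a⟫ : ℝ) * ⟪b, b⟫ = (⟪a, b⟫ : ℝ) ^ 2 := by
  have hn' : (⟪n, n⟫ : ℝ) = 1 := by rw [real_inner_self_eq_norm_sq, hn, one_pow]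
  have gram : det3 a b n ^ 2 = (⟪a, a⟫ : ℝ) * ⟪b, b⟫ * ⟪n, n⟫
      + 2 * (⟪a, b⟫ : ℝ) * ⟪b, n⟫ * ⟪a, n⟫ - (⟪a, a⟫ : ℝ) * (⟪b, n⟫ : ℝ) ^ 2
      - (⟪b, b⟫ : ℝ) * (⟪a, n⟫ : ℝ) ^ 2 - (⟪n, n⟫ : ℝ) * (⟪a, b⟫ : ℝ) ^ 2 := by
    simp [-inner_self_eq_norm_sq_to_K, det3, cross3, e3,
      PiLp.inner_apply, Fin.sum_univ_three]
    ring
  rw [h, ha, hb, hn'] at gram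
  linarith

/-- A linear map from the plane into the orthogonal complement of a unit vector `n` has a
nontrivial kernel if the triple product of its columns with `n` vanishes. -/
theorem exists_ne_zero_of_det3_eq_zero {n : E3} (hn : ‖n‖ = 1) (A : ℝ × ℝ →L[ℝ] E3)
    (ha : (⟪A (1, 0), n⟫ : ℝ) = 0) (hb : (⟪A (0, 1), n⟫ : ℝ) = 0)
    (h : det3 (A (1, 0)) (A (0, 1)) n = 0) : ∃ z ≠ 0, A z = 0 := by
  have key := norm_sq_mul_norm_sq_eq_of_det3_eq_zero hn ha hb h
  by_cases hb0 : A (0, 1) = 0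
  · exact ⟨(0, 1), by simp, hb0⟩
  refine ⟨(⟪A (0, 1), A (0, 1)⟫, -⟪A (1, 0), A (0, 1)⟫), fun hz => ?_, ?_⟩
  · exact hb0 (inner_self_eq_zero.1 (congrArg Prod.fst hz))
  · have hA : ∀ s t : ℝ, A (s, t) = s • A (1, 0) + t • A (0, 1) := fun s t => by
      rw [← map_smul, ← map_smul, ← map_add]; simp
    rw [hA, ← inner_self_eq_zero (𝕜 := ℝ)]
    simp only [inner_add_left, inner_add_right, real_inner_smul_left, real_inner_smul_right,
      real_inner_comm (A (1, 0)) (A (0, 1))]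
    linear_combination (⟪A (0, 1), A (0, 1)⟫ : ℝ) * key

/-- Linear algebra behind the immersion criterion: `A`, `B`, `c` play the roles of the
differentials of the front, its unit normal `n` and the principal curvature, and `w` that of a
principal vector. -/
theorem injective_focal_differential_iff {n : E3} (hn : ‖n‖ = 1) (A B D : ℝ × ℝ →L[ℝ] E3)
    (c : ℝ × ℝ →L[ℝ] ℝ) {k : ℝ} (hk : k ≠ 0) (hA : ∀ x, (⟪A x, n⟫ : ℝ) = 0)
    (hB : ∀ x, (⟪B x, n⟫ : ℝ) = 0) {w : ℝ × ℝ} (hw : w ≠ 0) (hAB : k • A w + B w = 0)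
    {z : ℝ × ℝ} (hAz : A z = 0) (hBz : B z ≠ 0)
    (hD : ∀ x, D x = A x + k⁻¹ • B x - (c x / k ^ 2) • n) :
    Function.Injective D ↔ c w ≠ 0 := by
  have hn' : (⟪n, n⟫ : ℝ) = 1 := by rw [real_inner_self_eq_norm_sq, hn, one_pow]
  have hTw : A w + k⁻¹ • B w = 0 := by
    rw [← smul_right_injective E3 hk |>.eq_iff]
    simpa [smul_smul, hk] using hAB
  rw [injective_iff_map_eq_zero]
  constructor
  · intro hinj hc
    exact hw (hinj w (by rw [hD, hTw, hc]; simp))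
  · intro hc x hx
    rw [hD] at hx
    have hcx : c x = 0 := by
      have := congrArg (fun y => (⟪y, n⟫ : ℝ)) hx
      simpa [inner_sub_left, inner_add_left, real_inner_smul_left, hA, hB, hn, hn', hk] using this
    have hTx : A x + k⁻¹ • B x = 0 := by simpa [hcx] using hx
    have hdet : x.1 * w.2 - x.2 * w.1 = 0 := by
      by_contra hd
      have hz : (x.1 * w.2 - x.2 * w.1) • z
          = (z.1 * w.2 - z.2 * w.1) • x + (x.1 * z.2 - x.2 * z.1) • w := by
        ext <;> simp <;> ring
      have hT : (x.1 * w.2 - x.2 * w.1) • (A z + k⁻¹ • B z) = 0 := by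
        have : (A + k⁻¹ • B) ((x.1 * w.2 - x.2 * w.1) • z) = 0 := by
          rw [hz, map_add, map_smul, map_smul]
          simp [hTx, hTw]
        rwa [map_smul] at this
      rw [hAz, zero_add] at hT
      simp [hd, hk, hBz] at hT
    have h1 : w.1 • x = x.1 • w := by
      ext <;> simp <;> linarith
    have h2 : w.2 • x = x.2 • w := by
      ext <;> simp <;> linarith
    have h1 := congrArg c h1
    have h2 := congrArg c h2
    simp only [map_smul, hcx, smul_eq_mul, mul_zero, zero_eq_mul, hc, or_false] at h1 h2
    exact Prod.ext h1 h2

/-- the focal surface `FC_f = f + (1/κ)ν` is an immersion at `p` iff `p` is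
not a ridge point, i.e. `Vκ(p) ≠ 0`. -/
theorem stmt8
    (U : Set (ℝ × ℝ)) (hU : IsOpen U)
    (f ν : ℝ × ℝ → E3)
    (hf : ContDiffOn ℝ (⊤ : ℕ∞) f U) (hν : ContDiffOn ℝ (⊤ : ℕ∞) ν U)
    (hν1 : ∀ q ∈ U, ‖ν q‖ = 1)
    (ho1 : ∀ q ∈ U, (⟪pu f q, ν q⟫ : ℝ) = 0)
    (ho2 : ∀ q ∈ U, (⟪pv f q, ν q⟫ : ℝ) = 0)
    (hfront : ∀ q ∈ U, Function.Injective ⇑(fderiv ℝ (fun x => (f x, ν x)) q))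
    (p : ℝ × ℝ) (hpU : p ∈ U)
    (hsing : lam f ν p = 0)
    (hnd : fderiv ℝ (lam f ν) p ≠ 0)
    (κ : ℝ × ℝ → ℝ) (hκsm : ContDiffOn ℝ (⊤ : ℕ∞) κ U) (hκ0 : κ p ≠ 0)
    (hprin : ∀ q ∈ U, lam f ν q ≠ 0 → κ q ^ 2 - 2 * Hff f ν q * κ q + Kff f ν q = 0)
    (V₁ V₂ : ℝ × ℝ → ℝ) (hV1 : ContDiffOn ℝ (⊤ : ℕ∞) V₁ U) (hV2 : ContDiffOn ℝ (⊤ : ℕ∞) V₂ U)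
    (hVp : (V₁ p, V₂ p) ≠ (0, 0))
    (hVprin : ∀ q ∈ U, κ q • fderiv ℝ f q (V₁ q, V₂ q) + fderiv ℝ ν q (V₁ q, V₂ q) = 0) :
    Function.Injective ⇑(fderiv ℝ (fun q => f q + (κ q)⁻¹ • ν q) p) ↔
      dirD V₁ V₂ κ p ≠ 0 := by
  have hnhds : U ∈ nhds p := hU.mem_nhds hpU
  have hfd : DifferentiableAt ℝ f p := (hf.contDiffAt hnhds).differentiableAt (by simp)
  have hνd : DifferentiableAt ℝ ν p := (hν.contDiffAt hnhds).differentiableAt (by simp)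
  have hκd : DifferentiableAt ℝ κ p := (hκsm.contDiffAt hnhds).differentiableAt (by simp)
  have hlin : ∀ {E : Type} [NormedAddCommGroup E] [NormedSpace ℝ E] (T : ℝ × ℝ →L[ℝ] E)
      (s t : ℝ), T (s, t) = s • T (1, 0) + t • T (0, 1) := fun T s t => by
    rw [← map_smul, ← map_smul, ← map_add]; simp
  have hA : ∀ x, (⟪fderiv ℝ f p x, ν p⟫ : ℝ) = 0 := by
    rintro ⟨s, t⟩
    have h1 := ho1 p hpU
    have h2 := ho2 p hpU
    rw [pu] at h1
    rw [pv] at h2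
    rw [hlin, inner_add_left, real_inner_smul_left, real_inner_smul_left, h1, h2]
    simp
  have hB : ∀ x, (⟪fderiv ℝ ν p x, ν p⟫ : ℝ) = 0 := by
    intro x
    have hconst : (fun q => (⟪ν q, ν q⟫ : ℝ)) =ᶠ[nhds p] fun _ => 1 := by
      filter_upwards [hnhds] with q hq
      rw [real_inner_self_eq_norm_sq, hν1 q hq, one_pow]
    have h := congrArg (fun T : ℝ × ℝ →L[ℝ] ℝ => T x) hconst.fderiv_eq
    simp only [fderiv_inner_apply ℝ hνd hνd, fderiv_const_apply, zero_apply,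
      real_inner_comm (ν p) (fderiv ℝ ν p x)] at h
    have := real_inner_comm (ν p) (fderiv ℝ ν p x)
    linarith
  obtain ⟨z, hz, hAz⟩ := exists_ne_zero_of_det3_eq_zero (hν1 p hpU) (fderiv ℝ f p)
    (hA _) (hA _) hsing
  have hBz : fderiv ℝ ν p z ≠ 0 := by
    intro hBz
    apply hz
    apply hfront p hpU
    rw [hfd.fderiv_prodMk hνd]
    simp [hAz, hBz]
  have hdir : dirD V₁ V₂ κ p = fderiv ℝ κ p (V₁ p, V₂ p) := by
    rw [hlin]; rfl
  rw [hdir]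
  refine injective_focal_differential_iff (hν1 p hpU) (fderiv ℝ f p) (fderiv ℝ ν p) _
    (fderiv ℝ κ p) hκ0 hA hB hVp (hVprin p hpU) hAz hBz fun x => ?_
  have hinv : HasFDerivAt (fun q => (κ q)⁻¹) ((-(κ p ^ 2)⁻¹) • fderiv ℝ κ p) p :=
    (hasDerivAt_inv hκ0).comp_hasFDerivAt (f := κ) p hκd.hasFDerivAt
  rw [(hfd.hasFDerivAt.fun_add (hinv.fun_smul hνd.hasFDerivAt)).fderiv]
  simp [div_eq_mul_inv, mul_comm]
  abel
end
end

section
/- Under the adapted cuspidal-edge setting, at every point p = (u₀,0) of the u-axis the focal surface ŴFC_f = f + (λ/κ̂)ν satisfies (ŴFC_f)_u(p) = f_u(p) and (ŴFC_f)_v(p) = (|(f_u×h)(p)|/κ̂(p))·ν(p); in particular ŴFC_f is an immersion at p, its tangent plane at p is spanned by the orthogonal vectors f_u(p) and ν(p), and this tangent plane intersects the limiting tangent plane of f at f(p) (the plane through f(p) orthogonal to ν(p)) orthogonally, i.e. the normal vector f_u(p)×ν(p) of ŴFC_f at p is orthogonal to the normal vector ν(p) of the limiting tangent plane. -/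
noncomputable section

local notation "⟪" x ", " y "⟫" => @inner ℝ _ _ x y

/-- A continuous multiple of the second coordinate is differentiable where that coordinate
vanishes. -/
theorem hasFDerivAt_snd_smul {E : Type*} [NormedAddCommGroup E] [NormedSpace ℝ E]
    {G : ℝ × ℝ → E} {p : ℝ × ℝ} (hG : ContinuousAt G p) (hp : p.2 = 0) :
    HasFDerivAt (fun q => q.2 • G q) ((ContinuousLinearMap.snd ℝ ℝ ℝ).smulRight (G p)) p := by
  rw [hasFDerivAt_iff_isLittleO]
  have hGo : (fun q => G q - G p) =o[nhds p] (fun _ => (1 : ℝ)) :=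
    (Asymptotics.isLittleO_one_iff ℝ).2 (tendsto_sub_nhds_zero_iff.2 hG)
  have hsnd : (fun q : ℝ × ℝ => q.2) =O[nhds p] (fun q => q - p) :=
    Asymptotics.IsBigO.of_bound 1 (Filter.Eventually.of_forall fun q => by
      simpa [hp] using norm_snd_le (q - p))
  refine ((hsnd.norm_right.smul_isLittleO hGo).congr (fun q => ?_) fun q => ?_).of_norm_right
  · simp [hp, smul_sub]
  · simp

theorem ContinuousAt.cross3 {X : Type*} [TopologicalSpace X] {a b : X → E3} {x : X}
    (ha : ContinuousAt a x) (hb : ContinuousAt b x) :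
    ContinuousAt (fun y => cross3 (a y) (b y)) x := by
  unfold _root_.cross3 e3
  refine (PiLp.continuous_toLp 2 _).continuousAt.comp (continuousAt_pi.2 fun i => ?_)
  fin_cases i <;> simp <;> fun_prop

theorem det3_eq_inner_cross3 (a b c : E3) : det3 a b c = ⟪cross3 a b, c⟫ := by
  simp [det3, cross3, e3, PiLp.inner_apply, Fin.sum_univ_three]
  ring

theorem det3_smul_middle (t : ℝ) (a b c : E3) : det3 a (t • b) c = t * det3 a b c := by
  simp [det3, cross3, e3, PiLp.inner_apply, Fin.sum_univ_three]
  ring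

theorem inner_cross3_right (a b : E3) : (⟪cross3 a b, b⟫ : ℝ) = 0 := by
  simp [cross3, e3, PiLp.inner_apply, Fin.sum_univ_three]
  ring

theorem cross3_zero_left (b : E3) : cross3 0 b = 0 := by
  ext i
  fin_cases i <;> simp [cross3, e3]

theorem ContinuousLinearMap.apply_prod_eq_smul_add_smul (D : ℝ × ℝ →L[ℝ] E3) (w : ℝ × ℝ) :
    D w = w.1 • D (1, 0) + w.2 • D (0, 1) := by
  rw [← map_smul, ← map_smul, ← map_add]
  simp

theorem lam_eq_snd_mul {f ν h : ℝ × ℝ → E3} {p : ℝ × ℝ} (hν1 : ‖ν p‖ = 1)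
    (hfv : pv f p = p.2 • h p)
    (hνdef : ν p = ‖cross3 (pu f p) (h p)‖⁻¹ • cross3 (pu f p) (h p)) :
    lam f ν p = p.2 * ‖cross3 (pu f p) (h p)‖ := by
  rw [lam, hfv, det3_smul_middle, det3_eq_inner_cross3]
  congr 1
  have hc : ‖cross3 (pu f p) (h p)‖ ≠ 0 := by
    intro hc
    simp [hνdef, hc] at hν1
  rw [hνdef, inner_smul_right, real_inner_self_eq_norm_sq]
  field_simp

theorem kaphat_ne_zero {f ν h : ℝ × ℝ → E3} {p : ℝ × ℝ} (hp : p.2 = 0)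
    (hc : cross3 (pu f p) (h p) ≠ 0) (hN : 0 < Ntil ν h p) : kaphat f ν h p ≠ 0 := by
  have hfu : pu f p ≠ 0 := fun h0 => hc (by rw [h0, cross3_zero_left])
  have hE : 0 < Etil f p := pow_pos (norm_pos_iff.2 hfu) 2
  have hA : 0 < Atil f ν h p := by
    simpa [Atil, hp] using mul_pos hE hN
  have hB : 0 ≤ Btil f ν h p := Real.sqrt_nonneg _
  have hc' : 0 < ‖cross3 (pu f p) (h p)‖ := norm_pos_iff.2 hc
  unfold kaphat
  positivity

theorem continuousAt_kaphat {f ν h : ℝ × ℝ → E3} {p : ℝ × ℝ}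
    (hfu : ContinuousAt (pu f) p) (hνu : ContinuousAt (pu ν) p) (hνv : ContinuousAt (pv ν) p)
    (hh : ContinuousAt h p) (hc : cross3 (pu f p) (h p) ≠ 0) :
    ContinuousAt (kaphat f ν h) p := by
  have hE : ContinuousAt (Etil f) p := hfu.norm.pow 2
  have hF : ContinuousAt (Ftil f h) p := hfu.inner hh
  have hG : ContinuousAt (Gtil h) p := hh.norm.pow 2
  have hL : ContinuousAt (Ltil f ν) p := (hfu.inner hνu).neg
  have hM : ContinuousAt (Mtil ν h) p := (hh.inner hνu).neg
  have hN : ContinuousAt (Ntil ν h) p := (hh.inner hνv).neg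
  have hA : ContinuousAt (Atil f ν h) p := by
    unfold Atil
    fun_prop
  have hB : ContinuousAt (Btil f ν h) p := by
    unfold Btil
    fun_prop
  have hX := hfu.cross3 hh
  exact (hA.add hB).div (continuousAt_const.mul hX.norm)
    (mul_ne_zero two_ne_zero (norm_ne_zero_iff.2 hc))

theorem continuousAt_fderiv_apply {U : Set (ℝ × ℝ)} (hU : IsOpen U) {g : ℝ × ℝ → E3}
    (hg : ContDiffOn ℝ (⊤ : ℕ∞) g U) {p : ℝ × ℝ} (hp : p ∈ U) (w : ℝ × ℝ) :
    ContinuousAt (fun q => fderiv ℝ g q w) p :=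
  ((hg.continuousOn_fderiv_of_isOpen hU (by simp)).continuousAt (hU.mem_nhds hp)).clm_apply
    continuousAt_const

/-- Along the `u`-axis the differential of the focal surface is `df + (|f_u×h|/κ̂) dv ⊗ ν`. -/
theorem hasFDerivAt_FChat {U : Set (ℝ × ℝ)} (hU : IsOpen U) {f ν h : ℝ × ℝ → E3}
    (hf : ContDiffOn ℝ (⊤ : ℕ∞) f U) (hν : ContDiffOn ℝ (⊤ : ℕ∞) ν U)
    (hh : ContinuousOn h U) (hν1 : ∀ p ∈ U, ‖ν p‖ = 1)
    (hfv : ∀ p ∈ U, pv f p = p.2 • h p)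
    (hνdef : ∀ p ∈ U, ν p = ‖cross3 (pu f p) (h p)‖⁻¹ • cross3 (pu f p) (h p))
    {p : ℝ × ℝ} (hpU : p ∈ U) (hp : p.2 = 0)
    (hc : cross3 (pu f p) (h p) ≠ 0) (hκ : kaphat f ν h p ≠ 0) :
    HasFDerivAt (FChat f ν h) (fderiv ℝ f p + (ContinuousLinearMap.snd ℝ ℝ ℝ).smulRight
      ((‖cross3 (pu f p) (h p)‖ / kaphat f ν h p) • ν p)) p := by
  have hUp : U ∈ nhds p := hU.mem_nhds hpU
  have hfu : ContinuousAt (pu f) p := continuousAt_fderiv_apply hU hf hpU _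
  have hhp : ContinuousAt h p := hh.continuousAt hUp
  have hκc : ContinuousAt (kaphat f ν h) p :=
    continuousAt_kaphat hfu (continuousAt_fderiv_apply hU hν hpU _)
      (continuousAt_fderiv_apply hU hν hpU _) hhp hc
  have hG : ContinuousAt
      (fun q => (‖cross3 (pu f q) (h q)‖ / kaphat f ν h q) • ν q) p :=
    ((hfu.cross3 hhp).norm.div hκc hκ).smul (hν.continuousOn.continuousAt hUp)
  have hfp : HasFDerivAt f (fderiv ℝ f p) p :=
    ((hf.contDiffAt hUp).differentiableAt (by simp)).hasFDerivAt
  refine (hfp.add (hasFDerivAt_snd_smul hG hp)).congr_of_eventuallyEq ?_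
  filter_upwards [hUp] with q hq
  simp [FChat, lam_eq_snd_mul (hν1 q hq) (hfv q hq) (hνdef q hq), smul_smul, mul_div_assoc]

/-- at `p = (u₀,0)` on the u-axis, `(ŴFC_f)_u(p) = f_u(p)`,
`(ŴFC_f)_v(p) = (|f_u×h|/κ̂)·ν(p)`; in particular `ŴFC_f` is an immersion at `p`, its tangent
plane is spanned by the orthogonal vectors `f_u(p)`, `ν(p)`, and this plane meets the limiting
tangent plane of `f` orthogonally (`f_u(p)×ν(p) ⊥ ν(p)`). -/
theorem stmt11
    (U : Set (ℝ × ℝ)) (hU : IsOpen U)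
    (f ν h : ℝ × ℝ → E3)
    (hf : ContDiffOn ℝ (⊤ : ℕ∞) f U) (hν : ContDiffOn ℝ (⊤ : ℕ∞) ν U) (hhsm : ContDiffOn ℝ (⊤ : ℕ∞) h U)
    (hax : ∃ p ∈ U, p.2 = (0 : ℝ))
    (hν1 : ∀ p ∈ U, ‖ν p‖ = 1)
    (ho1 : ∀ p ∈ U, (⟪pu f p, ν p⟫ : ℝ) = 0)
    (ho2 : ∀ p ∈ U, (⟪pv f p, ν p⟫ : ℝ) = 0)
    (hfront : ∀ p ∈ U, Function.Injective ⇑(fderiv ℝ (fun q => (f q, ν q)) p))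
    (hlam : ∀ p ∈ U, (lam f ν p = 0 ↔ p.2 = 0))
    (hh0 : ∀ p ∈ U, h p ≠ 0)
    (hfv : ∀ p ∈ U, pv f p = p.2 • h p)
    (hνdef : ∀ p ∈ U, ν p = ‖cross3 (pu f p) (h p)‖⁻¹ • cross3 (pu f p) (h p))
    (hNpos : ∀ p ∈ U, p.2 = 0 → 0 < Ntil ν h p)
    (u₀ : ℝ) (hp : ((u₀, 0) : ℝ × ℝ) ∈ U) :
    pu (FChat f ν h) (u₀, 0) = pu f (u₀, 0) ∧
    pv (FChat f ν h) (u₀, 0) =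
      (‖cross3 (pu f (u₀, 0)) (h (u₀, 0))‖ / kaphat f ν h (u₀, 0)) • ν (u₀, 0) ∧
    Function.Injective ⇑(fderiv ℝ (FChat f ν h) (u₀, 0)) ∧
    LinearMap.range (fderiv ℝ (FChat f ν h) (u₀, 0)).toLinearMap =
      Submodule.span ℝ {pu f (u₀, 0), ν (u₀, 0)} ∧
    (⟪pu f (u₀, 0), ν (u₀, 0)⟫ : ℝ) = 0 ∧
    (⟪cross3 (pu f (u₀, 0)) (ν (u₀, 0)), ν (u₀, 0)⟫ : ℝ) = 0 := by
  set p : ℝ × ℝ := (u₀, 0) with hpdef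
  have hp2 : p.2 = 0 := rfl
  have hc : cross3 (pu f p) (h p) ≠ 0 := by
    intro hc
    have h1 := hν1 p hp
    simp [hνdef p hp, hc] at h1
  have hfu : pu f p ≠ 0 := fun h0 => hc (by rw [h0, cross3_zero_left])
  have hν0 : ν p ≠ 0 := norm_ne_zero_iff.1 (by simp [hν1 p hp])
  have hκ : kaphat f ν h p ≠ 0 := kaphat_ne_zero hp2 hc (hNpos p hp hp2)
  have hD := (hasFDerivAt_FChat hU hf hν hhsm.continuousOn hν1 hfv hνdef hp hp2 hc hκ).fderiv
  have hfv0 : fderiv ℝ f p (0, 1) = 0 := (hfv p hp).trans (by simp [hp2])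
  set s : ℝ := ‖cross3 (pu f p) (h p)‖ / kaphat f ν h p with hs
  have hs0 : s ≠ 0 := div_ne_zero (norm_ne_zero_iff.2 hc) hκ
  have hu : pu (FChat f ν h) p = pu f p := by
    simp [pu, hD]
  have hv : pv (FChat f ν h) p = s • ν p := by
    simp [pv, hD, hfv0]
  have happ : ∀ w : ℝ × ℝ,
      fderiv ℝ (FChat f ν h) p w = w.1 • pu f p + (w.2 * s) • ν p := by
    intro w
    rw [ContinuousLinearMap.apply_prod_eq_smul_add_smul, mul_smul, ← hv, ← hu]
    rfl
  have ho := ho1 p hp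
  refine ⟨hu, hv, ?_, ?_, ho, inner_cross3_right _ _⟩
  · rw [injective_iff_map_eq_zero]
    intro w hw
    rw [happ] at hw
    have h1 := congrArg (fun x => ⟪pu f p, x⟫) hw
    have h2 := congrArg (fun x => ⟪x, ν p⟫) hw
    simp only [inner_add_right, inner_smul_right, ho, inner_zero_right, mul_zero, add_zero,
      mul_eq_zero, inner_self_eq_zero, hfu, or_false] at h1
    simp only [inner_add_left, real_inner_smul_left, ho, inner_zero_left, mul_zero, zero_add,
      mul_eq_zero, inner_self_eq_zero, hν0, hs0, or_false] at h2
    exact Prod.ext h1 h2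
  · ext x
    rw [Submodule.mem_span_pair]
    constructor
    · rintro ⟨w, rfl⟩
      exact ⟨w.1, w.2 * s, (happ w).symm⟩
    · rintro ⟨a, b, rfl⟩
      refine ⟨(a, b / s), ?_⟩
      change fderiv ℝ (FChat f ν h) p (a, b / s) = _
      rw [happ, div_mul_cancel₀ b hs0]
end
end
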